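/- arXiv:2103.01083 — 4 statements merged into one kernel-verified Lean document; each statement's English description precedes it below -/
import Mathlib

section
/- There exists a constant C > 0 depending only on σ and β (in particular independent of ε, N and of the mesh-generating function φ) such that max_{1≤i≤N/4} Θ_i ≤ C · N⁻¹ · sup_{t∈[0,1/4]} |ψ′(t)|. -/
/-- A layer-adapted mesh for a singularly perturbed reaction–diffusion problem,
with parameters `β, σ > 0`, number of elements `N` (a multiple of 4, `N ≥ 4`),
perturbation parameter `ε` with `√ε ≤ N⁻¹`, and mesh-generating function `φ`
(with derivative `φ'` on `[0, 1/4]`). -/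
structure LayerMesh (β σ : ℝ) (N : ℕ) (ε : ℝ) (φ φ' : ℝ → ℝ) where
  hβ : 0 < β
  hσ : 0 < σ
  hN : 4 ≤ N
  hN4 : N % 4 = 0
  hε : 0 < ε
  hεN : Real.sqrt ε ≤ (N : ℝ)⁻¹
  hderiv : ∀ t ∈ Set.Icc (0:ℝ) (1/4), HasDerivWithinAt φ (φ' t) (Set.Icc (0:ℝ) (1/4)) t
  hcont : ContinuousOn φ' (Set.Icc (0:ℝ) (1/4))
  hφ0 : φ 0 = 0
  hφ'pos : ∀ t ∈ Set.Icc (0:ℝ) (1/4), 0 < φ' t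
  hφ'mono : ∀ s ∈ Set.Icc (0:ℝ) (1/4), ∀ t ∈ Set.Icc (0:ℝ) (1/4), s ≤ t → φ' s ≤ φ' t
  hτ : σ * Real.sqrt ε / β * φ (1/4) ≤ 1/4
  x : ℕ → ℝ
  hx_left : ∀ i : ℕ, i ≤ N / 4 → x i = σ * Real.sqrt ε / β * φ ((i : ℝ) / (N : ℝ))
  hx_mid : ∀ i : ℕ, N / 4 < i → i < 3 * N / 4 →
    x i = σ * Real.sqrt ε / β * φ (1/4)
      + 2 * (1 - 2 * (σ * Real.sqrt ε / β * φ (1/4))) * ((i : ℝ) / (N : ℝ) - 1/4)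
  hx_right : ∀ i : ℕ, 3 * N / 4 ≤ i → i ≤ N →
    x i = 1 - σ * Real.sqrt ε / β * φ (1 - (i : ℝ) / (N : ℝ))

namespace LayerMesh

variable {β σ ε : ℝ} {N : ℕ} {φ φ' : ℝ → ℝ}

/-- The mesh width `h_i = x_i − x_{i−1}`. -/
noncomputable def h (M : LayerMesh β σ N ε φ φ') (i : ℕ) : ℝ := M.x i - M.x (i - 1)

/-- The quantity `Θ_i = min{h_i/√ε, 1} · e^{−β x_{i−1}/(σ√ε)}`, for `1 ≤ i ≤ N/4`. -/
noncomputable def Θ (M : LayerMesh β σ N ε φ φ') (i : ℕ) : ℝ :=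
  min (M.h i / Real.sqrt ε) 1 * Real.exp (-(β * M.x (i - 1)) / (σ * Real.sqrt ε))

end LayerMesh

/-- `sup_{t ∈ [0,1/4]} |ψ'(t)|` where `ψ = e^{−φ}`, so `ψ' = −φ'·e^{−φ}`. -/
noncomputable def psiSup (φ φ' : ℝ → ℝ) : ℝ :=
  sSup ((fun t => |(-(φ' t)) * Real.exp (-(φ t))|) '' Set.Icc (0:ℝ) (1/4))

theorem min_mul_one_le_one_sub_exp_neg {k d : ℝ} (hk : 0 ≤ k) (hd : 0 ≤ d) :
    min (k * d) 1 ≤ (1 + k) * (1 - Real.exp (-d)) := by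
  have hexp : Real.exp (-d) * (1 + d) ≤ 1 := by
    calc Real.exp (-d) * (1 + d) ≤ Real.exp (-d) * Real.exp d := by
          gcongr
          linarith [Real.add_one_le_exp d]
      _ = 1 := by rw [← Real.exp_add]; simp
  have hmin : min (k * d) 1 * (1 + d) ≤ (1 + k) * d := by
    nlinarith [min_le_left (k * d) 1, mul_le_mul_of_nonneg_right (min_le_right (k * d) 1) hd]
  have hmul : (1 + k) * d ≤ (1 + k) * (1 - Real.exp (-d)) * (1 + d) := by
    nlinarith [mul_le_mul_of_nonneg_left hexp (by linarith : 0 ≤ 1 + k)]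
  exact le_of_mul_le_mul_right (hmin.trans hmul) (by linarith)

namespace LayerMesh

variable {β σ ε : ℝ} {N : ℕ} {φ φ' : ℝ → ℝ}

theorem abs_deriv_exp_neg_le_psiSup (M : LayerMesh β σ N ε φ φ') {t : ℝ}
    (ht : t ∈ Set.Icc (0 : ℝ) (1 / 4)) :
    |(-(φ' t)) * Real.exp (-(φ t))| ≤ psiSup φ φ' := by
  have hφ : ContinuousOn φ (Set.Icc (0 : ℝ) (1 / 4)) :=
    fun s hs => (M.hderiv s hs).continuousWithinAt
  have hc : ContinuousOn (fun t => |(-(φ' t)) * Real.exp (-(φ t))|)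
      (Set.Icc (0 : ℝ) (1 / 4)) :=
    (M.hcont.neg.mul (Real.continuous_exp.comp_continuousOn hφ.neg)).abs
  exact le_csSup (isCompact_Icc.bddAbove_image hc) ⟨t, ht, rfl⟩

theorem exp_neg_sub_le (M : LayerMesh β σ N ε φ φ') {a b : ℝ}
    (ha : a ∈ Set.Icc (0 : ℝ) (1 / 4)) (hb : b ∈ Set.Icc (0 : ℝ) (1 / 4)) (hab : a ≤ b) :
    Real.exp (-(φ a)) - Real.exp (-(φ b)) ≤ psiSup φ φ' * (b - a) := by
  have h := (convex_Icc (0 : ℝ) (1 / 4)).norm_image_sub_le_of_norm_hasDerivWithin_le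
    (f := fun t => Real.exp (-(φ t))) (f' := fun t => (-(φ' t)) * Real.exp (-(φ t)))
    (C := psiSup φ φ')
    (fun t ht => by simpa [mul_comm] using (M.hderiv t ht).neg.exp)
    (fun t ht => M.abs_deriv_exp_neg_le_psiSup ht) hb ha
  rw [Real.norm_eq_abs, Real.norm_eq_abs, abs_sub_comm a b,
    abs_of_nonneg (sub_nonneg.2 hab)] at h
  exact (le_abs_self _).trans h

theorem monotoneOn (M : LayerMesh β σ N ε φ φ') :
    MonotoneOn φ (Set.Icc (0 : ℝ) (1 / 4)) := by
  refine monotoneOn_of_hasDerivWithinAt_nonneg (convex_Icc _ _)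
    (fun s hs => (M.hderiv s hs).continuousWithinAt)
    (fun t ht => (M.hderiv t (interior_subset ht)).mono interior_subset)
    (fun t ht => (M.hφ'pos t (interior_subset ht)).le)

theorem Θ_eq (M : LayerMesh β σ N ε φ φ') {i : ℕ} (hi : i ≤ N / 4) :
    M.Θ i = min (σ / β * (φ ((i : ℝ) / N) - φ (((i - 1 : ℕ) : ℝ) / N))) 1 *
      Real.exp (-(φ (((i - 1 : ℕ) : ℝ) / N))) := by
  have hs : Real.sqrt ε ≠ 0 := (Real.sqrt_pos.2 M.hε).ne'
  have hβ := M.hβ.ne'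
  have hσ := M.hσ.ne'
  unfold Θ h
  rw [M.hx_left i hi, M.hx_left (i - 1) (by omega)]
  congr 2 <;> field_simp

end LayerMesh

theorem stmt0 (β σ : ℝ) (hβ : 0 < β) (hσ : 0 < σ) :
    ∃ C : ℝ, 0 < C ∧
      ∀ (N : ℕ) (ε : ℝ) (φ φ' : ℝ → ℝ) (M : LayerMesh β σ N ε φ φ'),
        ∀ i : ℕ, 1 ≤ i → i ≤ N / 4 →
          M.Θ i ≤ C * (N : ℝ)⁻¹ * psiSup φ φ' := by
  have hk : 0 < σ / β := div_pos hσ hβ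
  refine ⟨1 + σ / β, by linarith, fun N ε φ φ' M i hi hiN => ?_⟩
  have hN : (0 : ℝ) < N := by
    have := M.hN
    exact_mod_cast (by omega : 0 < N)
  have hmem : ∀ j ≤ N / 4, (j : ℝ) / N ∈ Set.Icc (0 : ℝ) (1 / 4) := fun j hj => by
    have h4 : (j : ℝ) * 4 ≤ N := by exact_mod_cast (by omega : j * 4 ≤ N)
    refine ⟨by positivity, ?_⟩
    rw [div_le_iff₀ hN]
    linarith
  have hb := hmem i hiN
  have ha := hmem (i - 1) (by omega)
  have hba : (i : ℝ) / N - ((i - 1 : ℕ) : ℝ) / N = (N : ℝ)⁻¹ := by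
    rw [Nat.cast_sub hi]
    field_simp
    simp
  rw [M.Θ_eq hiN]
  set b : ℝ := (i : ℝ) / N
  set a : ℝ := ((i - 1 : ℕ) : ℝ) / N
  have hab : a ≤ b := by linarith [inv_pos.2 hN]
  calc min (σ / β * (φ b - φ a)) 1 * Real.exp (-(φ a))
      ≤ (1 + σ / β) * (1 - Real.exp (-(φ b - φ a))) * Real.exp (-(φ a)) := by
        gcongr
        exact min_mul_one_le_one_sub_exp_neg hk.le (sub_nonneg.2 (M.monotoneOn ha hb hab))
    _ = (1 + σ / β) * (Real.exp (-(φ a)) - Real.exp (-(φ b))) := by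
        rw [mul_assoc, sub_mul, ← Real.exp_add]
        ring_nf
    _ ≤ (1 + σ / β) * (psiSup φ φ' * (b - a)) := by
        gcongr
        exact M.exp_neg_sub_le ha hb hab
    _ = (1 + σ / β) * (N : ℝ)⁻¹ * psiSup φ φ' := by
        rw [hba]
        ring
end

section
/- Assume additionally that sup_{t∈[0,1/4]} |ψ′(t)| = φ′(0) (i.e. |ψ′| attains its maximum at t = 0, as holds for the Shishkin, Bakhvalov–Shishkin and Bakhvalov-type meshes) and that √ε · φ′(0) ≤ β/σ. Then the minimal mesh width ℏ := min_{1≤i≤N} h_i satisfies ℏ ≥ (σ/β) · √ε · N⁻¹ · sup_{t∈[0,1/4]} |ψ′(t)|. -/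
namespace LayerMesh

variable {β σ ε : ℝ} {N : ℕ} {φ φ' : ℝ → ℝ}

theorem mul_sub_le_image_sub (M : LayerMesh β σ N ε φ φ') {a b : ℝ} (ha : 0 ≤ a) (hab : a ≤ b)
    (hb : b ≤ 1 / 4) : φ' 0 * (b - a) ≤ φ b - φ a := by
  have hd : ∀ t ∈ interior (Set.Icc (0 : ℝ) (1 / 4)), HasDerivAt φ (φ' t) t := fun t ht =>
    (M.hderiv t (interior_subset ht)).hasDerivAt (mem_interior_iff_mem_nhds.mp ht)
  refine (convex_Icc (0 : ℝ) (1 / 4)).mul_sub_le_image_sub_of_le_deriv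
    (fun t ht => (M.hderiv t ht).continuousWithinAt)
    (fun t ht => (hd t ht).differentiableAt.differentiableWithinAt)
    (fun t ht => ?_) a ⟨ha, hab.trans hb⟩ b ⟨ha.trans hab, hb⟩ hab
  rw [(hd t ht).deriv]
  have ht' := interior_subset ht
  exact M.hφ'mono 0 ⟨le_rfl, by norm_num⟩ t ht' ht'.1

/-- The formula for the coarse part of the mesh also holds at the two transition points. -/
theorem x_eq_of_mid (M : LayerMesh β σ N ε φ φ') {i : ℕ} (hl : N / 4 ≤ i)
    (hr : i ≤ 3 * N / 4) :
    M.x i = σ * Real.sqrt ε / β * φ (1 / 4)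
      + 2 * (1 - 2 * (σ * Real.sqrt ε / β * φ (1 / 4))) * ((i : ℝ) / (N : ℝ) - 1 / 4) := by
  have hN := M.hN
  have hN4 := M.hN4
  have hN0 : (N : ℝ) ≠ 0 := by exact_mod_cast (by omega : N ≠ 0)
  rcases hl.eq_or_lt with hi | hl
  · have h4 : (i : ℝ) / N = 1 / 4 := by
      rw [div_eq_div_iff hN0 (by norm_num)]
      exact_mod_cast (by omega : i * 4 = 1 * N)
    rw [M.hx_left i hi.ge, h4]
    ring
  rcases hr.eq_or_lt with hi | hr
  · have h4 : (i : ℝ) / N = 3 / 4 := by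
      rw [div_eq_div_iff hN0 (by norm_num)]
      exact_mod_cast (by omega : i * 4 = 3 * N)
    rw [M.hx_right i hi.ge (by omega), h4, show (1 - 3 / 4 : ℝ) = 1 / 4 by norm_num]
    ring
  · exact M.hx_mid i hl hr

end LayerMesh

theorem stmt3 (β σ ε : ℝ) (N : ℕ) (φ φ' : ℝ → ℝ) (M : LayerMesh β σ N ε φ φ')
    (hmax : psiSup φ φ' = φ' 0)
    (hsmall : Real.sqrt ε * φ' 0 ≤ β / σ) :
    ∀ i : ℕ, 1 ≤ i → i ≤ N →
      σ / β * Real.sqrt ε * (N : ℝ)⁻¹ * psiSup φ φ' ≤ M.h i := by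
  intro i hi hiN
  obtain ⟨j, rfl⟩ : ∃ j, i = j + 1 := ⟨i - 1, by omega⟩
  have hN := M.hN
  have hN4 := M.hN4
  have hβ := M.hβ
  have hσ := M.hσ
  have hNpos : (0 : ℝ) < N := by exact_mod_cast (by omega : 0 < N)
  have hc : 0 ≤ σ * Real.sqrt ε / β := by positivity
  have hstep : ((j + 1 : ℕ) : ℝ) / N = (j : ℝ) / N + (N : ℝ)⁻¹ := by
    push_cast
    ring
  have hinv : (0 : ℝ) ≤ (N : ℝ)⁻¹ := by positivity
  rw [hmax, LayerMesh.h, Nat.add_sub_cancel,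
    show σ / β * Real.sqrt ε * (N : ℝ)⁻¹ * φ' 0
      = σ * Real.sqrt ε / β * (φ' 0 * (N : ℝ)⁻¹) by ring]
  rcases Nat.lt_or_ge j (N / 4) with hl | hl
  · have hb : ((j + 1 : ℕ) : ℝ) / N ≤ 1 / 4 := by
      rw [div_le_div_iff₀ hNpos (by norm_num)]
      exact_mod_cast (by omega : (j + 1) * 4 ≤ 1 * N)
    have key := M.mul_sub_le_image_sub (a := (j : ℝ) / N) (by positivity)
      (by rw [hstep]; linarith) hb
    rw [hstep, add_sub_cancel_left, ← hstep] at key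
    rw [M.hx_left _ hl, M.hx_left _ hl.le, ← mul_sub]
    exact mul_le_mul_of_nonneg_left key hc
  rcases Nat.lt_or_ge j (3 * N / 4) with hr | hr
  · rw [M.x_eq_of_mid (by omega) hr, M.x_eq_of_mid hl hr.le, hstep]
    have h1 : σ * Real.sqrt ε / β * φ' 0 ≤ 1 := by
      rw [le_div_iff₀ hσ] at hsmall
      rw [div_mul_eq_mul_div, div_le_one hβ]
      linarith
    have h2 := mul_le_mul_of_nonneg_right h1 hinv
    have h3 := mul_le_mul_of_nonneg_right M.hτ hinv
    linarith
  · have hb : 1 - (j : ℝ) / N ≤ 1 / 4 := by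
      have : (3 / 4 : ℝ) ≤ (j : ℝ) / N := by
        rw [div_le_div_iff₀ (by norm_num) hNpos]
        exact_mod_cast (by omega : 3 * N ≤ j * 4)
      linarith
    have ha : ((j + 1 : ℕ) : ℝ) / N ≤ 1 := by
      rw [div_le_one hNpos]
      exact_mod_cast hiN
    have key := M.mul_sub_le_image_sub (a := 1 - ((j + 1 : ℕ) : ℝ) / N) (by linarith)
      (by rw [hstep]; linarith) hb
    have hlen : 1 - (j : ℝ) / N - (1 - ((j + 1 : ℕ) : ℝ) / N) = (N : ℝ)⁻¹ := by
      rw [hstep]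
      ring
    rw [hlen] at key
    rw [M.hx_right _ (by omega) hiN, M.hx_right _ hr (by omega)]
    linarith [mul_le_mul_of_nonneg_left key hc]
end

section
/- There exists an absolute constant C > 0 such that for every multiple of four N ≥ 12, every ε > 0 with √ε ≤ N⁻¹, and every index 1 ≤ i ≤ N/4 − 2 one has C ≤ Δ_i/Δ_{i+1} ≤ 1, where Δ_i := φ(i/N) − φ((i−1)/N) and φ(t) = −ln(1 − 4(1 − √ε)t). Consequently, on the Bakhvalov-type mesh, whose layer widths are h_i = (σ√ε/β)·Δ_i, one has C ≤ h_i/h_{i+1} ≤ 1 for 1 ≤ i ≤ N/4 − 2. -/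
/-- If `0 < d ≤ p`, the increments of `log` over the adjacent intervals `[p + d, p + 2d]` and
`[p, p + d]` have ratio between `1/3` and `1`. -/
theorem log_increment_ratio_bounds {p d : ℝ} (hd : 0 < d) (hp : d ≤ p) :
    1 / 3 ≤ (Real.log (p + 2 * d) - Real.log (p + d)) / (Real.log (p + d) - Real.log p) ∧
      (Real.log (p + 2 * d) - Real.log (p + d)) / (Real.log (p + d) - Real.log p) ≤ 1 := by
  have hp0 : 0 < p := hd.trans_le hp
  have hden : 0 < Real.log (p + d) - Real.log p :=
    sub_pos.2 (Real.log_lt_log hp0 (by linarith))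
  have hupper : Real.log (p + d) - Real.log p ≤ d / p := by
    rw [← Real.log_div (by positivity) (by positivity)]
    refine (Real.log_le_sub_one_of_pos (by positivity)).trans_eq ?_
    field_simp
    ring
  have hlower : d / (p + 2 * d) ≤ Real.log (p + 2 * d) - Real.log (p + d) := by
    rw [← Real.log_div (by positivity) (by positivity)]
    refine Eq.trans_le ?_ (Real.one_sub_inv_le_log_of_pos (by positivity))
    field_simp
    ring
  rw [le_div_iff₀ hden, div_le_one hden]
  constructor
  · have hcompare : 1 / 3 * (d / p) ≤ d / (p + 2 * d) := by
      rw [div_mul_div_comm, div_le_div_iff₀ (by positivity) (by positivity)]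
      nlinarith
    linarith
  · have hlog : Real.log ((p + 2 * d) * p) ≤ Real.log ((p + d) * (p + d)) :=
      Real.log_le_log (by positivity) (by nlinarith)
    rw [Real.log_mul (by positivity) (by positivity),
      Real.log_mul (by positivity) (by positivity)] at hlog
    linarith


/-- On the Bakhvalov-type mesh, consecutive layer mesh widths are comparable away
from the transition point: there is an absolute constant `C > 0` with
`C ≤ Δᵢ/Δᵢ₊₁ ≤ 1` (and hence `C ≤ hᵢ/hᵢ₊₁ ≤ 1`) for `1 ≤ i ≤ N/4 − 2`. -/
theorem stmt5 :
    ∃ C : ℝ, 0 < C ∧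
      ∀ N : ℕ, 12 ≤ N → N % 4 = 0 →
        ∀ ε : ℝ, 0 < ε → Real.sqrt ε ≤ (N : ℝ)⁻¹ →
          ∀ i : ℕ, 1 ≤ i → i ≤ N / 4 - 2 →
            let φ : ℝ → ℝ := fun t => -Real.log (1 - 4 * (1 - Real.sqrt ε) * t)
            let Δ : ℕ → ℝ := fun j => φ ((j : ℝ) / (N : ℝ)) - φ (((j : ℝ) - 1) / (N : ℝ))
            (C ≤ Δ i / Δ (i + 1) ∧ Δ i / Δ (i + 1) ≤ 1) ∧
            ∀ β σ : ℝ, 0 < β → 0 < σ →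
              let h : ℕ → ℝ := fun j => σ * Real.sqrt ε / β * Δ j
              C ≤ h i / h (i + 1) ∧ h i / h (i + 1) ≤ 1 := by
  refine ⟨1 / 3, by norm_num, ?_⟩
  intro N hN _ ε hε hεN i _ hi φ Δ
  have hN0 : (0 : ℝ) < N := by exact_mod_cast (by omega : 0 < N)
  have hN12 : (12 : ℝ) ≤ N := by exact_mod_cast hN
  have hs : 0 < Real.sqrt ε := Real.sqrt_pos.2 hε
  have hs1 : Real.sqrt ε < 1 :=
    hεN.trans_lt (inv_lt_one_of_one_lt₀ (by linarith))
  have hiN : 4 * ((i : ℝ) + 2) ≤ N := by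
    exact_mod_cast (by omega : 4 * (i + 2) ≤ N)
  set d : ℝ := 4 * (1 - Real.sqrt ε) / N with hd_def
  set p : ℝ := 1 - d * (i + 1) with hp_def
  have hd : 0 < d := div_pos (by linarith) hN0
  have hp : d ≤ p := by
    have hdi : d * (i + 2) ≤ 1 := by
      rw [hd_def, div_mul_eq_mul_div, div_le_one hN0]
      nlinarith
    linarith
  have hφ : ∀ x : ℝ, φ (x / N) = -Real.log (1 - d * x) := fun x => by
    simp only [φ, hd_def]
    ring_nf
  have hΔ : Δ i = Real.log (p + 2 * d) - Real.log (p + d) := by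
    simp only [Δ, hφ, hp_def]
    ring_nf
  have hΔ' : Δ (i + 1) = Real.log (p + d) - Real.log p := by
    simp only [Δ, hφ, hp_def]
    push_cast
    ring_nf
  have hratio : 1 / 3 ≤ Δ i / Δ (i + 1) ∧ Δ i / Δ (i + 1) ≤ 1 := by
    rw [hΔ, hΔ']
    exact log_increment_ratio_bounds hd hp
  refine ⟨hratio, fun β σ hβ hσ => ?_⟩
  have hc : σ * Real.sqrt ε / β ≠ 0 := by positivity
  simpa only [mul_div_mul_left _ _ hc] using hratio
end

section
/- Let β > 0 and ε > 0, and define u(x,y) = e^{−βx/√ε} on Ω = (0,1)². Then ε‖∂_x u‖²_{L²(Ω)} + ε‖∂_y u‖²_{L²(Ω)} + 2β²‖u‖²_{L²(Ω)} = (3β/2)·√ε·(1 − e^{−2β/√ε}). In particular, for 0 < ε ≤ β² this quantity lies between (3β/4)·√ε and (3β/2)·√ε, so the energy norm |||(u, ε∂_x u, ε∂_y u)||| = (ε⁻¹‖ε∂_x u‖² + ε⁻¹‖ε∂_y u‖² + 2β²‖u‖²)^{1/2} of the boundary-layer function u is of exact order ε^{1/4} and tends to 0 as ε → 0. -/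
open MeasureTheory

theorem integral_Ioo_exp_mul {c : ℝ} (hc : c ≠ 0) :
    ∫ x in Set.Ioo (0:ℝ) 1, Real.exp (c * x) = (Real.exp c - 1) / c := by
  rw [← integral_Ioc_eq_integral_Ioo, ← intervalIntegral.integral_of_le zero_le_one,
    intervalIntegral.integral_comp_mul_left _ hc, integral_exp]
  simp [div_eq_inv_mul]

theorem setIntegral_unitSquare_fst (f : ℝ → ℝ) :
    ∫ p in Set.Ioo (0:ℝ) 1 ×ˢ Set.Ioo (0:ℝ) 1, f p.1 = ∫ x in Set.Ioo (0:ℝ) 1, f x := by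
  have h := setIntegral_prod_mul (μ := volume) (ν := volume) f (fun _ : ℝ => (1:ℝ))
    (Set.Ioo (0:ℝ) 1) (Set.Ioo (0:ℝ) 1)
  simpa [Measure.volume_eq_prod] using h

theorem hasFDerivAt_exp_fst (c : ℝ) (p : ℝ × ℝ) :
    HasFDerivAt (fun p : ℝ × ℝ => Real.exp (c * p.1))
      (Real.exp (c * p.1) • c • ContinuousLinearMap.fst ℝ ℝ ℝ) p :=
  ((hasFDerivAt_fst (𝕜 := ℝ) (p := p)).const_mul c).exp

/-- The energy norm of the boundary-layer function `u(x,y) = e^{−βx/√ε}` (together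
with its scaled fluxes `ε∂ₓu, ε∂_yu`) for the reaction coefficient `b ≡ 2β²` is of
exact order `ε^{1/4}`:
`ε‖∂ₓu‖² + ε‖∂_yu‖² + 2β²‖u‖² = (3β/2)√ε(1 − e^{−2β/√ε})`, and for `ε ≤ β²` this
quantity lies between `(3β/4)√ε` and `(3β/2)√ε`. -/
theorem stmt14 (β ε : ℝ) (hβ : 0 < β) (hε : 0 < ε) :
    let Ω : Set (ℝ × ℝ) := Set.Ioo (0:ℝ) 1 ×ˢ Set.Ioo (0:ℝ) 1
    let u : ℝ × ℝ → ℝ := fun p => Real.exp (-(β * p.1) / Real.sqrt ε)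
    let E : ℝ :=
      ε * (∫ p in Ω, (fderiv ℝ u p (1, 0)) ^ 2)
        + ε * (∫ p in Ω, (fderiv ℝ u p (0, 1)) ^ 2)
        + 2 * β ^ 2 * (∫ p in Ω, (u p) ^ 2)
    E = 3 * β / 2 * Real.sqrt ε * (1 - Real.exp (-(2 * β) / Real.sqrt ε)) ∧
    (ε ≤ β ^ 2 →
      3 * β / 4 * Real.sqrt ε ≤ E ∧ E ≤ 3 * β / 2 * Real.sqrt ε ∧
      Real.sqrt (3 * β / 4) * ε ^ ((1:ℝ)/4) ≤ Real.sqrt E ∧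
      Real.sqrt E ≤ Real.sqrt (3 * β / 2) * ε ^ ((1:ℝ)/4)) := by
  intro Ω u E
  set s := Real.sqrt ε with hs
  have hs0 : 0 < s := Real.sqrt_pos.2 hε
  have hss : s ^ 2 = ε := Real.sq_sqrt hε.le
  have hu : u = fun p => Real.exp (-(β / s) * p.1) := by
    funext p
    simp only [u]
    congr 1
    ring
  have hI : ∫ p in Ω, (u p) ^ 2 = s / (2 * β) * (1 - Real.exp (-(2 * β) / s)) := by
    have hsq : ∀ p : ℝ × ℝ, (u p) ^ 2 = Real.exp (-(2 * β) / s * p.1) := by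
      intro p
      simp only [hu, ← Real.exp_nat_mul]
      congr 1
      push_cast
      ring
    simp only [hsq]
    rw [setIntegral_unitSquare_fst (fun x => Real.exp (-(2 * β) / s * x)),
      integral_Ioo_exp_mul (div_ne_zero (by linarith) hs0.ne')]
    field_simp
    ring
  have hx : ∀ p, (fderiv ℝ u p (1, 0)) ^ 2 = (β / s) ^ 2 * (u p) ^ 2 := by
    intro p
    rw [hu, (hasFDerivAt_exp_fst _ p).fderiv]
    simp
    ring
  have hy : ∀ p, (fderiv ℝ u p (0, 1)) ^ 2 = 0 := by
    intro p
    rw [hu, (hasFDerivAt_exp_fst _ p).fderiv]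
    simp
  have hE : E = 3 * β / 2 * s * (1 - Real.exp (-(2 * β) / s)) := by
    simp only [E, hx, hy, integral_const_mul, hI, integral_zero, ← hss]
    field_simp
    ring
  refine ⟨hE, fun hle => ?_⟩
  have hsβ : s ≤ β := Real.sqrt_le_iff.2 ⟨hβ.le, hle⟩
  have hexp : Real.exp (-(2 * β) / s) ≤ 1 / 2 := by
    have h2 : 1 ≤ 2 * β / s := (one_le_div hs0).2 (by linarith)
    rw [neg_div, Real.exp_neg, one_div]
    exact inv_anti₀ two_pos (by linarith [Real.add_one_le_exp (2 * β / s)])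
  have hc : 0 < 3 * β / 2 * s := by positivity
  have hlow : 3 * β / 4 * s ≤ E := by rw [hE]; nlinarith
  have hupp : E ≤ 3 * β / 2 * s := by
    rw [hE]; nlinarith [Real.exp_pos (-(2 * β) / s)]
  have hroot : ε ^ ((1:ℝ)/4) = Real.sqrt s := by
    rw [hs, Real.sqrt_eq_rpow, Real.sqrt_eq_rpow, ← Real.rpow_mul hε.le]
    norm_num
  refine ⟨hlow, hupp, ?_, ?_⟩
  · rw [hroot, ← Real.sqrt_mul (by positivity)]
    exact Real.sqrt_le_sqrt hlow
  · rw [hroot, ← Real.sqrt_mul (by positivity)]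
    exact Real.sqrt_le_sqrt hupp
end
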